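/- Let C = 𝔽₂[t, t⁻¹] and let D = 𝔽₂[t², t⁻²] ⊆ C, so that C is a free D-module with basis {1, t}. Let δ : C → C be the unique D-linear map with δ(1) = 0 and δ(t) = t⁻⁴. Then δ∘δ = 0 and ker δ = im δ, i.e. the homology of (C, δ) vanishes. (This is the paper's d₇-stage computation in the Bockstein spectral sequence for the coefficients: with t = v₂⁴, the differential d₇(v₂⁴) = v̂₂v₂⁻⁸ = v₂⁻¹⁶ kills everything, so E₈ = 0.) -/

import Mathlib

noncomputable section

open LaurentPolynomial

/-- The ring `C = 𝔽₂[t, t⁻¹]` (with `t = T 1`), modeling the page `ℤ/2[v₂^{±4}]`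
of the Bockstein spectral sequence for the coefficients. -/
abbrev CPage : Type := LaurentPolynomial (ZMod 2)

/-- The subring `D = 𝔽₂[t², t⁻²] ⊆ C`. -/
def DPage : Subring CPage := Subring.closure {T 2, T (-2)}

theorem T_mem_DPage_of_even {m : ℤ} (hm : Even m) : (T m : CPage) ∈ DPage := by
  obtain ⟨k, rfl⟩ := hm.exists_two_nsmul
  obtain ⟨n, rfl | rfl⟩ := k.eq_nat_or_neg
  · have h : (T 2 : CPage) ^ n ∈ DPage :=
      pow_mem (Subring.subset_closure (by simp)) n
    rwa [T_pow, show (n : ℤ) * 2 = 2 • (n : ℤ) by simp [mul_comm]] at h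
  · have h : (T (-2) : CPage) ^ n ∈ DPage :=
      pow_mem (Subring.subset_closure (by simp)) n
    rwa [T_pow, show (n : ℤ) * -2 = 2 • (-n : ℤ) by simp [mul_comm]] at h

theorem C_mem_DPage (a : ZMod 2) : (C a : CPage) ∈ DPage := by
  fin_cases a
  · exact (map_zero C : (C 0 : CPage) = 0) ▸ zero_mem _
  · exact (map_one C : (C 1 : CPage) = 1) ▸ one_mem _

theorem exists_eq_add_mul_T_one (y : CPage) :
    ∃ b₁ ∈ DPage, ∃ b₂ ∈ DPage, y = b₁ + b₂ * T 1 := by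
  induction y using LaurentPolynomial.induction_on' with
  | add p q hp hq =>
    obtain ⟨a₁, ha₁, a₂, ha₂, rfl⟩ := hp
    obtain ⟨b₁, hb₁, b₂, hb₂, rfl⟩ := hq
    exact ⟨a₁ + b₁, add_mem ha₁ hb₁, a₂ + b₂, add_mem ha₂ hb₂, by ring⟩
  | C_mul_T n a =>
    have h (k : ℤ) : C a * T (2 * k) ∈ DPage :=
      mul_mem (C_mem_DPage a) (T_mem_DPage_of_even (even_two_mul k))
    obtain ⟨k, rfl | rfl⟩ := n.even_or_odd'
    · exact ⟨_, h k, 0, zero_mem _, by simp⟩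
    · exact ⟨0, zero_mem _, _, h k, by rw [T_add, zero_add, mul_assoc]⟩

/-- Let `C = 𝔽₂[t,t⁻¹]` and `D = 𝔽₂[t²,t⁻²] ⊆ C`, so that `C`
is a free `D`-module with basis `{1, t}`, and let `δ : C → C` be the unique
`D`-linear map with `δ(1) = 0` and `δ(t) = t⁻⁴` (so `δ(b₁ + b₂t) = b₂t⁻⁴` for
`b₁, b₂ ∈ D`).  Then `δ∘δ = 0` and `ker δ = im δ`, i.e. the homology of `(C, δ)`
vanishes. -/
theorem bockstein_d7_coefficients
    (δ : CPage → CPage)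
    (hδ : ∀ b₁ b₂ : CPage, b₁ ∈ DPage → b₂ ∈ DPage →
      δ (b₁ + b₂ * T 1) = b₂ * T (-4)) :
    (∀ y, δ (δ y) = 0) ∧ (∀ y, δ y = 0 ↔ ∃ x, δ x = y) := by
  have hδ_mem (b : CPage) (hb : b ∈ DPage) : δ b = 0 := by
    simpa using hδ b 0 hb (zero_mem _)
  have hδδ (y : CPage) : δ (δ y) = 0 := by
    obtain ⟨b₁, hb₁, b₂, hb₂, rfl⟩ := exists_eq_add_mul_T_one y
    rw [hδ b₁ b₂ hb₁ hb₂]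
    exact hδ_mem _ (mul_mem hb₂ (T_mem_DPage_of_even (by decide)))
  refine ⟨hδδ, fun y => ⟨fun hy => ?_, ?_⟩⟩
  · obtain ⟨b₁, hb₁, b₂, hb₂, rfl⟩ := exists_eq_add_mul_T_one y
    rw [hδ b₁ b₂ hb₁ hb₂, (isUnit_T (-4)).mul_left_eq_zero] at hy
    refine ⟨0 + b₁ * T 4 * T 1, ?_⟩
    rw [hδ 0 (b₁ * T 4) (zero_mem _) (mul_mem hb₁ (T_mem_DPage_of_even (by decide))), hy,
      mul_assoc, ← T_add]
    simp
  · rintro ⟨x, rfl⟩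
    exact hδδ x
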